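/- arXiv:1605.03375 — 2 statements merged into one kernel-verified Lean document; each statement's English description precedes it below -/
import Mathlib

section
/- Let s and t be integers with 3 ≤ s < t. If u, v, w are nonnegative integers satisfying u + v + w = 2^t − 4 and (2^s+1)·u + (2^(s−1)+1)·v + w = (2^(s−1)+4)·(2^t − 1), then the multinomial coefficient (2^t−4)! / (u!·v!·w!) is even. -/
theorem two_dvd_choose_of_even_of_odd {n k : ℕ} (hn : Even n) (hk : Odd k) :
    2 ∣ n.choose k := by
  obtain ⟨j, rfl⟩ := hk
  rcases n with _ | n
  · exact dvd_zero 2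
  · have h := Nat.add_one_mul_choose_eq n (2 * j)
    have hd : 2 ∣ (n + 1).choose (2 * j + 1) * (2 * j + 1) :=
      h ▸ hn.two_dvd.mul_right _
    exact (Nat.Prime.dvd_mul Nat.prime_two).mp hd |>.resolve_right (by omega)

theorem factorial_add_add_div_eq_choose_mul_choose (u v w : ℕ) :
    (u + v + w).factorial / (u.factorial * v.factorial * w.factorial) =
      (u + v + w).choose v * (u + w).choose u := by
  apply Nat.div_eq_of_eq_mul_left (by positivity)
  have hv := Nat.choose_mul_factorial_mul_factorial (show v ≤ u + v + w by omega)
  have hu := Nat.choose_mul_factorial_mul_factorial (show u ≤ u + w by omega)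
  rw [show u + v + w - v = u + w by omega] at hv
  rw [show u + w - u = w by omega] at hu
  rw [← hv, ← hu]
  ring

/-- Case 2, `ℓ = 2^(s-1)+4`: for `3 ≤ s < t`, if `u + v + w = 2^t - 4` and
`(2^s+1)u + (2^(s-1)+1)v + w = (2^(s-1)+4)(2^t-1)`, then the multinomial
coefficient `(2^t-4)! / (u!·v!·w!)` is even. -/
theorem multinomial_even_case_two_ell_large
    (s t : ℕ) (hs : 3 ≤ s) (hst : s < t) (u v w : ℕ)
    (h1 : u + v + w = 2 ^ t - 4)
    (h2 : (2 ^ s + 1) * u + (2 ^ (s - 1) + 1) * v + w =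
      (2 ^ (s - 1) + 4) * (2 ^ t - 1)) :
    2 ∣ (2 ^ t - 4).factorial / (u.factorial * v.factorial * w.factorial) := by
  obtain ⟨r, rfl⟩ : ∃ r, s = r + 1 := ⟨s - 1, by omega⟩
  obtain ⟨k, rfl⟩ : ∃ k, t = r + (k + 1) := ⟨t - r - 1, by omega⟩
  have h4 : 4 ≤ 2 ^ (r + (k + 1)) := by
    calc 4 = 2 ^ 2 := rfl
      _ ≤ _ := Nat.pow_le_pow_right (by omega) (by omega)
  have heven : Even (2 ^ (r + (k + 1)) - 4) :=
    (Nat.even_sub h4).mpr (iff_of_true (even_two.pow_of_ne_zero (by omega)) (by decide))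
  have hv : Odd v := by
    rw [Nat.add_sub_cancel] at h2
    zify [h4, show 1 ≤ 2 ^ (r + (k + 1)) by omega] at h1 h2
    have h2v : (2 * u + v : ℤ) = 2 ^ r * (2 * 2 ^ k) - 1 + 3 * (2 * 2 ^ k) := by
      apply mul_left_cancel₀ (show (2 ^ r : ℤ) ≠ 0 by positivity)
      simp only [pow_add, pow_one] at h1 h2
      linear_combination h2 - h1
    rw [← Int.odd_coe_nat]
    exact ⟨2 ^ r * 2 ^ k - 1 + 3 * 2 ^ k - u, by linear_combination h2v⟩
  rw [← h1] at heven ⊢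
  rw [factorial_add_add_div_eq_choose_mul_choose]
  exact (two_dvd_choose_of_even_of_odd heven hv).mul_right _
end

section
/- Let s and t be integers with 3 ≤ s < t, and let u, v, w be nonnegative integers satisfying u + v + w = 2^t − 3 and (2^s+1)·u + (2^(s−1)+1)·v + w = 3·(2^t − 1). Then the multinomial coefficient (2^t−3)! / (u!·v!·w!) is odd if and only if u = 0 or u = 2^i for some i with 2 ≤ i ≤ t − s + 1. -/
theorem odd_choose_two_mul_add_iff (n k a b : ℕ) (ha : a < 2) (hb : b < 2) :
    Odd ((2 * n + a).choose (2 * k + b)) ↔ Odd (a.choose b) ∧ Odd (n.choose k) := by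
  have : Fact (Nat.Prime 2) := ⟨Nat.prime_two⟩
  have h : (2 * n + a).choose (2 * k + b) ≡ a.choose b * n.choose k [MOD 2] := by
    have h := Choose.choose_modEq_choose_mod_mul_choose_div_nat
      (n := 2 * n + a) (k := 2 * k + b) (p := 2)
    rwa [show (2 * n + a) % 2 = a by omega, show (2 * k + b) % 2 = b by omega,
      show (2 * n + a) / 2 = n by omega, show (2 * k + b) / 2 = k by omega] at h
  rw [← Nat.odd_mul, Nat.odd_iff, Nat.odd_iff, h]

theorem odd_choose_of_add_one_eq_two_pow {j n : ℕ} (hn : n + 1 = 2 ^ j) {m : ℕ} (hm : m ≤ n) :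
    Odd (n.choose m) := by
  induction j generalizing n m with
  | zero =>
    obtain rfl : n = 0 := by simpa using hn
    obtain rfl : m = 0 := by omega
    simp
  | succ j ih =>
    rw [pow_succ] at hn
    obtain ⟨n', rfl⟩ : ∃ n', n = 2 * n' + 1 := ⟨n / 2, by omega⟩
    have key := ih (n := n') (m := m / 2) (by omega) (by omega)
    rw [← Nat.div_add_mod m 2, odd_choose_two_mul_add_iff _ _ _ _ (by omega) (by omega)]
    refine ⟨?_, key⟩
    rcases Nat.mod_two_eq_zero_or_one m with h | h <;> simp [h]

theorem eq_zero_of_odd_choose {m n x : ℕ} (hn : n + x + 1 = 2 ^ m) (hx : x ≤ n)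
    (hodd : Odd (n.choose x)) : x = 0 := by
  induction m generalizing n x with
  | zero => rw [pow_zero] at hn; omega
  | succ m ih =>
    rw [pow_succ] at hn
    rcases Nat.even_or_odd' x with ⟨x', rfl | rfl⟩
    · obtain ⟨n', rfl⟩ : ∃ n', n = 2 * n' + 1 := ⟨n / 2, by omega⟩
      have h := (odd_choose_two_mul_add_iff n' x' 1 0 (by omega) (by omega)).1 hodd
      have := ih (n := n') (x := x') (by omega) (by omega) h.2
      omega
    · obtain ⟨n', rfl⟩ : ∃ n', n = 2 * n' := ⟨n / 2, by omega⟩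
      have h := (odd_choose_two_mul_add_iff n' x' 0 1 (by omega) (by omega)).1 hodd
      simp at h

theorem exists_eq_two_pow_of_odd_choose {k n u : ℕ} (hn : n + u = 2 ^ k) (hu : u ≤ n)
    (hpos : 0 < u) (hodd : Odd (n.choose u)) : ∃ a < k, u = 2 ^ a := by
  induction k generalizing n u with
  | zero => rw [pow_zero] at hn; omega
  | succ k ih =>
    rw [pow_succ] at hn
    rcases Nat.even_or_odd' u with ⟨x, rfl | rfl⟩
    · obtain ⟨y, rfl⟩ : ∃ y, n = 2 * y := ⟨n / 2, by omega⟩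
      have h := (odd_choose_two_mul_add_iff y x 0 0 (by omega) (by omega)).1 hodd
      obtain ⟨a, ha, rfl⟩ := ih (n := y) (u := x) (by omega) (by omega) (by omega) h.2
      exact ⟨a + 1, by omega, by ring⟩
    · obtain ⟨y, rfl⟩ : ∃ y, n = 2 * y + 1 := ⟨n / 2, by omega⟩
      have h := (odd_choose_two_mul_add_iff y x 1 1 (by omega) (by omega)).1 hodd
      obtain rfl := eq_zero_of_odd_choose (m := k) (n := y) (by omega) (by omega) h.2
      exact ⟨0, by omega, by simp⟩

theorem odd_choose_of_add_two_pow_eq {k n a : ℕ} (ha : a < k) (hn : n + 2 ^ a = 2 ^ k) :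
    Odd (n.choose (2 ^ a)) := by
  induction a generalizing k n with
  | zero =>
    refine odd_choose_of_add_one_eq_two_pow (j := k) (by simpa using hn) ?_
    have : 2 ^ 1 ≤ 2 ^ k := Nat.pow_le_pow_right (by norm_num) (by omega)
    rw [pow_zero] at hn ⊢
    omega
  | succ a ih =>
    obtain ⟨k, rfl⟩ : ∃ k', k = k' + 1 := ⟨k - 1, by omega⟩
    rw [pow_succ, pow_succ] at hn
    obtain ⟨y, rfl⟩ : ∃ y, n = 2 * y := ⟨n / 2, by omega⟩
    rw [pow_succ']
    exact (odd_choose_two_mul_add_iff y (2 ^ a) 0 0 (by omega) (by omega)).2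
      ⟨by simp, ih (k := k) (n := y) (by omega) (by omega)⟩

theorem odd_choose_iff_of_add_three_eq_two_pow {t n m : ℕ} (ht : 2 ≤ t) (hn : n + 3 = 2 ^ t)
    (hm : m ≤ n) : Odd (n.choose m) ↔ m % 4 < 2 := by
  obtain ⟨j, rfl⟩ : ∃ j, t = j + 2 := ⟨t - 2, by omega⟩
  rw [pow_add] at hn
  obtain ⟨q, rfl⟩ : ∃ q, n = 2 * (2 * q + 0) + 1 := ⟨n / 4, by omega⟩
  have key : Odd (q.choose (m / 2 / 2)) :=
    odd_choose_of_add_one_eq_two_pow (j := j) (by omega) (by omega)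
  rw [← Nat.div_add_mod m 2, ← Nat.div_add_mod (m / 2) 2,
    odd_choose_two_mul_add_iff _ _ _ _ (by omega) (by omega),
    odd_choose_two_mul_add_iff _ _ _ _ (by omega) (by omega)]
  have h1 : Odd (Nat.choose 1 (m % 2)) := by
    rcases Nat.mod_two_eq_zero_or_one m with h | h <;> simp [h]
  have h2 : Odd (Nat.choose 0 (m / 2 % 2)) ↔ m / 2 % 2 = 0 := by
    rcases Nat.mod_two_eq_zero_or_one (m / 2) with h | h <;> simp [h]
  simp only [h1, h2, key, true_and, and_true]
  omega

theorem factorial_div_eq_choose_mul_choose (u v w : ℕ) :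
    (u + v + w).factorial / (u.factorial * v.factorial * w.factorial) =
      (u + v + w).choose (u + v) * (u + v).choose u := by
  refine Nat.div_eq_of_eq_mul_left (by positivity) ?_
  rw [← Nat.add_choose_mul_factorial_mul_factorial (u + v) w,
    ← Nat.add_choose_mul_factorial_mul_factorial u v, Nat.choose_symm_add (a := u + v),
    Nat.choose_symm_add (a := u)]
  ring


/-- Subcase 1.1 (`ℓ = 3`): for `3 ≤ s < t`, if `u + v + w = 2^t - 3` and
`(2^s+1)u + (2^(s-1)+1)v + w = 3(2^t-1)`, then `(2^t-3)! / (u!·v!·w!)` is odd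
iff `u = 0` or `u = 2^i` for some `2 ≤ i ≤ t - s + 1`. -/
theorem multinomial_odd_iff_case_one
    (s t : ℕ) (hs : 3 ≤ s) (hst : s < t) (u v w : ℕ)
    (h1 : u + v + w = 2 ^ t - 3)
    (h2 : (2 ^ s + 1) * u + (2 ^ (s - 1) + 1) * v + w = 3 * (2 ^ t - 1)) :
    Odd ((2 ^ t - 3).factorial / (u.factorial * v.factorial * w.factorial)) ↔
      (u = 0 ∨ ∃ i : ℕ, 2 ≤ i ∧ i ≤ t - s + 1 ∧ u = 2 ^ i) := by
  obtain ⟨r, rfl⟩ : ∃ r, s = r + 1 := ⟨s - 1, by omega⟩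
  obtain ⟨d, rfl⟩ : ∃ d, t = r + 1 + d := ⟨t - (r + 1), by omega⟩
  have hbig : 2 ^ 3 ≤ 2 ^ (r + 1 + d) := Nat.pow_le_pow_right (by norm_num) (by omega)
  have hn : u + v + w + 3 = 2 ^ (r + 1 + d) := by omega
  have hsum : u + v + u = 2 ^ (d + 2) := by
    have h3 : (2 ^ (r + 1) + 1) * u + (2 ^ r + 1) * v + w + 3 = 3 * 2 ^ (r + 1 + d) := by
      simp only [Nat.add_sub_cancel] at h2
      omega
    have h4 : 2 ^ r * (u + v + u) = 2 ^ r * 2 ^ (d + 2) := by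
      rw [pow_succ] at h3
      have : 2 ^ r * 2 ^ (d + 2) = 2 * 2 ^ (r + 1 + d) := by ring
      linarith
    exact Nat.eq_of_mul_eq_mul_left (by positivity) h4
  have hd : 4 ∣ 2 ^ (d + 2) := ⟨2 ^ d, by ring⟩
  rw [← h1, factorial_div_eq_choose_mul_choose, Nat.odd_mul,
    odd_choose_iff_of_add_three_eq_two_pow (by omega) hn (by omega)]
  constructor
  · rintro ⟨hmod, hodd⟩
    rcases Nat.eq_zero_or_pos u with hu | hu
    · exact Or.inl hu
    · obtain ⟨a, ha, rfl⟩ := exists_eq_two_pow_of_odd_choose hsum (by omega) hu hodd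
      refine Or.inr ⟨a, ?_, by omega, rfl⟩
      by_contra! h
      interval_cases a <;> omega
  · rintro (rfl | ⟨i, hi, hit, rfl⟩)
    · exact ⟨by omega, by simp⟩
    · have hi4 : 4 ∣ 2 ^ i := pow_dvd_pow 2 hi
      exact ⟨by omega, odd_choose_of_add_two_pow_eq (by omega) hsum⟩
end
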